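/- arXiv:2505.11105 — 5 statements merged into one kernel-verified Lean document; each statement's English description precedes it below -/
import Mathlib

section
/- Let t ≥ 1, k ≥ 3 and r ≥ 2 be integers. If k > r, then there exist constants c, C > 0 and N such that c·n^r ≤ ex_r(n, F_{t,k}^r) ≤ C·n^r for all n ≥ N. If 2 < k ≤ r, then there exist constants c, C > 0 and N such that c·n^{r−1} ≤ ex_r(n, F_{t,k}^r) ≤ C·n^{r−1} for all n ≥ N. -/
/-- The `(t,k)`-fan `F_{t,k}`: `t` copies of `K_k` sharing exactly one common vertex
(`none` is the shared vertex; `some (i, a)` is the `a`-th other vertex of the `i`-th copy). -/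
def fanGraph (t k : ℕ) : SimpleGraph (Option (Fin t × Fin (k - 1))) :=
  SimpleGraph.fromRel fun x y =>
    match x, y with
    | none, _ => True
    | _, none => True
    | some p, some q => p.1 = q.1

/-- The `r`-graph `H` contains a copy of the `r`-expansion `F^r` of the graph `F`:
an injective embedding `φ` of the vertices of `F`, and for each edge of `F` a set of
`r - 2` new vertices, all new vertices being distinct from each other (across different
edges) and from the embedded vertices, such that each edge of `F` together with its
`r - 2` new vertices forms a hyperedge of `H`. -/
def ContainsExpansionR {α V : Type*} [DecidableEq V] (r : ℕ)
    (F : SimpleGraph α) (H : Finset (Finset V)) : Prop :=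
  ∃ (φ : α → V) (ψ : Sym2 α → Finset V),
    Function.Injective φ ∧
    (∀ e ∈ F.edgeSet, (ψ e).card = r - 2) ∧
    (∀ e ∈ F.edgeSet, ∀ x ∈ ψ e, x ∉ Set.range φ) ∧
    (∀ e ∈ F.edgeSet, ∀ e' ∈ F.edgeSet, e ≠ e' → Disjoint (ψ e) (ψ e')) ∧
    ∀ a b, F.Adj a b → ({φ a, φ b} : Finset V) ∪ ψ s(a, b) ∈ H

/-- The Turán number `ex_r(n, F_{t,k}^r)`. -/
noncomputable def exrFan (r t k n : ℕ) : ℕ :=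
  sSup {m | ∃ H : Finset (Finset (Fin n)),
    (∀ e ∈ H, e.card = r) ∧ ¬ ContainsExpansionR r (fanGraph t k) H ∧ H.card = m}

/-- In an `M`-thick family, each vertex of each member can be exchanged for a vertex
outside any prescribed set of size at most `M`, staying inside the family. -/
def IsThick {V : Type*} [DecidableEq V] (M : ℕ) (H : Finset (Finset V)) : Prop :=
  ∀ e ∈ H, ∀ x ∈ e, ∀ B : Finset V, B.card ≤ M → ∃ y ∉ B, insert y (e.erase x) ∈ H

lemma IsThick.exists_avoiding {V : Type*} [DecidableEq V] {M : ℕ} {H : Finset (Finset V)}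
    (hH : IsThick M H) {S B : Finset V} (hB : B.card ≤ M) {e : Finset V} (he : e ∈ H)
    (hS : S ⊆ e) : ∃ e' ∈ H, S ⊆ e' ∧ Disjoint (e' \ S) B := by
  induction hm : ((e \ S) ∩ B).card using Nat.strong_induction_on generalizing e with
  | _ m ih =>
    by_cases hd : Disjoint (e \ S) B
    · exact ⟨e, he, hS, hd⟩
    obtain ⟨x, hxe, hxB⟩ := Finset.not_disjoint_iff.1 hd
    rw [Finset.mem_sdiff] at hxe
    obtain ⟨y, hy, hye⟩ := hH e he x hxe.1 B hB
    refine ih _ ?_ hye ?_ rfl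
    · rw [← hm]
      apply Finset.card_lt_card
      rw [Finset.ssubset_iff_of_subset]
      · exact ⟨x, by grind, by grind⟩
      · intro z hz
        grind
    · intro z hz
      grind

lemma card_le_of_no_thick {V : Type*} [DecidableEq V] {M r : ℕ} (T H : Finset (Finset V))
    (hr : ∀ e ∈ H, e.card = r) (hT : ∀ e ∈ H, ∀ x ∈ e, e.erase x ∈ T)
    (hthick : ∀ H' ⊆ H, IsThick M H' → H' = ∅) : H.card ≤ M * T.card := by
  induction hm : T.card generalizing T H with
  | zero =>
    have hH : H = ∅ := by
      refine hthick H subset_rfl fun e he x hx => ?_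
      have := hT e he x hx
      simp [Finset.card_eq_zero.1 hm] at this
    simp [hH]
  | succ m ih =>
    by_cases hthin : IsThick M H
    · simp [hthick H subset_rfl hthin]
    unfold IsThick at hthin
    push Not at hthin
    obtain ⟨e, he, x, hx, B, hB, hy⟩ := hthin
    have hkeep : (H.filter (¬ e.erase x ⊆ ·)).card ≤ M * m := by
      refine ih (T.erase (e.erase x)) _ ?_ ?_ ?_ ?_
      · intro f hf
        exact hr f (Finset.mem_filter.1 hf).1
      · intro f hf z hz
        rw [Finset.mem_filter] at hf
        refine Finset.mem_erase.2 ⟨fun h => hf.2 ?_, hT f hf.1 z hz⟩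
        rw [← h]
        exact Finset.erase_subset _ _
      · exact fun H' hH' => hthick H' (hH'.trans (Finset.filter_subset _ _))
      · rw [Finset.card_erase_of_mem (hT e he x hx), hm, Nat.add_sub_cancel]
    have hdrop : (H.filter (e.erase x ⊆ ·)).card ≤ M := by
      refine le_trans (Finset.card_le_card (t := B.image (insert · (e.erase x))) ?_)
        (Finset.card_image_le.trans hB)
      intro f hf
      rw [Finset.mem_filter] at hf
      have hc : (f \ e.erase x).card = 1 := by
        rw [Finset.card_sdiff_of_subset hf.2, Finset.card_erase_of_mem hx, hr f hf.1, hr e he]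
        have : 0 < e.card := Finset.card_pos.2 ⟨x, hx⟩
        have := hr e he
        omega
      obtain ⟨y, hyf⟩ := Finset.card_eq_one.1 hc
      have hins : insert y (e.erase x) = f := by
        rw [Finset.insert_eq, ← hyf, Finset.sdiff_union_of_subset hf.2]
      refine Finset.mem_image.2 ⟨y, ?_, hins⟩
      by_contra hyB
      exact hy y hyB (hins ▸ hf.1)
    have := Finset.card_filter_add_card_filter_not (s := H) (e.erase x ⊆ ·)
    rw [Nat.mul_succ]
    omega

lemma IsThick.containsExpansionR {α V : Type*} [Fintype α] [DecidableEq V] {r M : ℕ}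
    {F : SimpleGraph α} {H : Finset (Finset V)} (hH : IsThick M H)
    (hr : ∀ e ∈ H, e.card = r) (hM : Fintype.card α + Nat.card (Sym2 α) * r ≤ M)
    {φ : α → V} (hφ : Function.Injective φ)
    (hadj : ∀ a b, F.Adj a b → ∃ e ∈ H, φ a ∈ e ∧ φ b ∈ e) : ContainsExpansionR r F H := by
  classical
  suffices key : ∀ E : Finset (Sym2 α), (∀ e ∈ E, e ∈ F.edgeSet) →
      ∃ ψ : Sym2 α → Finset V, (∀ e ∈ E, (ψ e).card = r - 2) ∧
        (∀ e ∈ E, ∀ x ∈ ψ e, x ∉ Set.range φ) ∧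
        (∀ e ∈ E, ∀ e' ∈ E, e ≠ e' → Disjoint (ψ e) (ψ e')) ∧
        ∀ e ∈ E, e.toFinset.image φ ∪ ψ e ∈ H by
    obtain ⟨ψ, h1, h2, h3, h4⟩ := key F.edgeFinset (by simp)
    simp only [SimpleGraph.mem_edgeFinset] at h1 h2 h3 h4
    refine ⟨φ, ψ, hφ, h1, h2, h3, fun a b hab => ?_⟩
    have := h4 s(a, b) hab
    rwa [Sym2.toFinset_mk_eq, Finset.image_insert, Finset.image_singleton] at this
  intro E
  induction E using Finset.induction_on with
  | empty => exact fun _ => ⟨fun _ => ∅, by simp⟩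
  | insert s E hs ih =>
    intro hE
    obtain ⟨ψ, h1, h2, h3, h4⟩ := ih fun e he => hE e (Finset.mem_insert_of_mem he)
    obtain ⟨f, hf, hsf⟩ : ∃ f ∈ H, s.toFinset.image φ ⊆ f := by
      have hsF := hE s (Finset.mem_insert_self _ _)
      induction s with | _ a b =>
      obtain ⟨f, hf, ha, hb⟩ := hadj a b hsF
      refine ⟨f, hf, ?_⟩
      rw [Sym2.toFinset_mk_eq, Finset.image_insert, Finset.image_singleton]
      grind
    have hcard : (s.toFinset.image φ).card = 2 := by
      rw [Finset.card_image_of_injective _ hφ]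
      exact Sym2.card_toFinset_of_not_isDiag _
        (F.not_isDiag_of_mem_edgeSet (hE s (Finset.mem_insert_self _ _)))
    have hB : (Finset.univ.image φ ∪ E.biUnion ψ).card ≤ M := by
      refine (Finset.card_union_le _ _).trans (le_trans (Nat.add_le_add ?_ ?_) hM)
      · exact Finset.card_image_le
      · refine (Finset.card_biUnion_le_card_mul _ _ r fun e he => ?_).trans ?_
        · rw [h1 e he]; omega
        · rw [Nat.card_eq_fintype_card]
          exact Nat.mul_le_mul_right _ (Finset.card_le_univ _)
    obtain ⟨g, hg, hsg, hdis⟩ := hH.exists_avoiding hB hf hsf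
    rw [Finset.disjoint_union_right] at hdis
    have hne : ∀ e ∈ E, e ≠ s := fun e he h => hs (h ▸ he)
    have hdis' : ∀ e ∈ E, Disjoint (g \ s.toFinset.image φ) (ψ e) := fun e he =>
      hdis.2.mono_right (Finset.subset_biUnion_of_mem ψ he)
    refine ⟨Function.update ψ s (g \ s.toFinset.image φ), ?_, ?_, ?_, ?_⟩
    · simp only [Finset.forall_mem_insert, Function.update_self]
      refine ⟨by rw [Finset.card_sdiff_of_subset hsg, hr g hg, hcard], fun e he => ?_⟩
      rw [Function.update_of_ne (hne e he)]
      exact h1 e he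
    · simp only [Finset.forall_mem_insert, Function.update_self]
      refine ⟨fun x hx => ?_, fun e he => ?_⟩
      · rintro ⟨a, rfl⟩
        exact Finset.disjoint_left.1 hdis.1 hx (by simp)
      · rw [Function.update_of_ne (hne e he)]
        exact h2 e he
    · simp only [Finset.forall_mem_insert, Function.update_self]
      refine ⟨⟨fun h => absurd rfl h, fun e he _ => ?_⟩, fun e he => ⟨fun _ => ?_, ?_⟩⟩
      · rw [Function.update_of_ne (hne e he)]
        exact hdis' e he
      · rw [Function.update_of_ne (hne e he)]
        exact (hdis' e he).symm
      · intro e' he' hee'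
        rw [Function.update_of_ne (hne e he), Function.update_of_ne (hne e' he')]
        exact h3 e he e' he' hee'
    · simp only [Finset.forall_mem_insert, Function.update_self]
      refine ⟨by rwa [Finset.union_sdiff_of_subset hsg], fun e he => ?_⟩
      rw [Function.update_of_ne (hne e he)]
      exact h4 e he

/-- A thick nonempty family contains a sunflower with `t` petals and a one-vertex kernel. -/
lemma IsThick.exists_sunflower {V : Type*} [DecidableEq V] {r M : ℕ} {H : Finset (Finset V)}
    (hH : IsThick M H) (hr : ∀ e ∈ H, e.card = r) {e₀ : Finset V} (he₀ : e₀ ∈ H) {v : V}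
    (hv : v ∈ e₀) (t : ℕ) (hM : t * r ≤ M) :
    ∃ e : ℕ → Finset V, (∀ i < t, e i ∈ H ∧ v ∈ e i) ∧
      ∀ i < t, ∀ j < t, i ≠ j → Disjoint ((e i).erase v) ((e j).erase v) := by
  induction t with
  | zero => exact ⟨fun _ => ∅, by simp⟩
  | succ t ih =>
    obtain ⟨e, h1, h2⟩ := ih (le_trans (Nat.mul_le_mul_right _ t.le_succ) hM)
    have hB : ((Finset.range t).biUnion e).card ≤ M := by
      refine (Finset.card_biUnion_le_card_mul _ _ r fun i hi => ?_).trans ?_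
      · exact (hr _ (h1 i (Finset.mem_range.1 hi)).1).le
      · rw [Finset.card_range]
        exact le_trans (Nat.mul_le_mul_right _ t.le_succ) hM
    obtain ⟨g, hg, hvg, hdis⟩ := hH.exists_avoiding hB he₀ (Finset.singleton_subset_iff.2 hv)
    rw [Finset.sdiff_singleton_eq_erase] at hdis
    have hdis' : ∀ i < t, Disjoint (g.erase v) ((e i).erase v) := fun i hi =>
      hdis.mono_right ((Finset.erase_subset _ _).trans
        (Finset.subset_biUnion_of_mem e (Finset.mem_range.2 hi)))
    refine ⟨Function.update e t g, fun i hi => ?_, fun i hi j hj hij => ?_⟩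
    · rcases Nat.lt_succ_iff_lt_or_eq.1 hi with hi | rfl
      · rw [Function.update_of_ne hi.ne]
        exact h1 i hi
      · rw [Function.update_self]
        exact ⟨hg, Finset.singleton_subset_iff.1 hvg⟩
    · rcases Nat.lt_succ_iff_lt_or_eq.1 hi with hi | rfl <;>
        rcases Nat.lt_succ_iff_lt_or_eq.1 hj with hj | rfl
      · rw [Function.update_of_ne hi.ne, Function.update_of_ne hj.ne]
        exact h2 i hi j hj hij
      · rw [Function.update_of_ne hi.ne, Function.update_self]
        exact (hdis' i hi).symm
      · rw [Function.update_of_ne hj.ne, Function.update_self]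
        exact hdis' j hj
      · exact absurd rfl hij

/-- A thickness guaranteeing a copy of the `r`-expansion of the `(t,k)`-fan. -/
noncomputable def fanThickness (t k r : ℕ) : ℕ :=
  t * r + (Fintype.card (Option (Fin t × Fin (k - 1))) +
    Nat.card (Sym2 (Option (Fin t × Fin (k - 1)))) * r)

lemma IsThick.containsExpansionR_fanGraph {V : Type*} [DecidableEq V] {t k r : ℕ}
    {H : Finset (Finset V)} (hH : IsThick (fanThickness t k r) H) (hne : H.Nonempty)
    (hr : ∀ e ∈ H, e.card = r) (hr0 : 0 < r) (hkr : k ≤ r) :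
    ContainsExpansionR r (fanGraph t k) H := by
  obtain ⟨e₀, he₀⟩ := hne
  obtain ⟨v, hv⟩ : e₀.Nonempty := Finset.card_pos.1 (by rw [hr e₀ he₀]; exact hr0)
  obtain ⟨e, h1, h2⟩ := hH.exists_sunflower hr he₀ hv t (Nat.le_add_right _ _)
  have hg : ∀ i : Fin t, ∃ g : Fin (k - 1) → V,
      Function.Injective g ∧ ∀ a, g a ∈ (e i).erase v := by
    intro i
    have hc : k - 1 ≤ ((e i).erase v).card := by
      rw [Finset.card_erase_of_mem (h1 i i.2).2, hr _ (h1 i i.2).1]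
      omega
    obtain ⟨s, hs, hsc⟩ := Finset.exists_subset_card_eq hc
    refine ⟨fun a => (s.equivFinOfCardEq hsc).symm a, ?_, fun a => hs (Subtype.prop _)⟩
    exact Subtype.val_injective.comp (Equiv.injective _)
  choose g hginj hgmem using hg
  have hgv : ∀ (i : Fin t) a, g i a ≠ v := fun i a => (Finset.mem_erase.1 (hgmem i a)).1
  have hge : ∀ (i : Fin t) a, g i a ∈ e i := fun i a => (Finset.mem_erase.1 (hgmem i a)).2
  refine hH.containsExpansionR (φ := fun x => x.elim v fun p => g p.1 p.2) hr
    (Nat.le_add_left _ _) ?_ ?_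
  · rintro (_ | ⟨i, a⟩) (_ | ⟨j, b⟩) h
    · rfl
    · exact absurd h.symm (hgv j b)
    · exact absurd h (hgv i a)
    · simp only [Option.elim_some] at h
      obtain rfl : i = j := by
        by_contra hij
        refine Finset.disjoint_left.1 (h2 i i.2 j j.2 (Fin.val_ne_of_ne hij)) (hgmem i a) ?_
        rw [h]
        exact hgmem j b
      rw [hginj i h]
  · rintro (_ | ⟨i, a⟩) (_ | ⟨j, b⟩) h
    · exact absurd rfl h.ne
    · exact ⟨e j, (h1 j j.2).1, (h1 j j.2).2, hge j b⟩
    · exact ⟨e i, (h1 i i.2).1, hge i a, (h1 i i.2).2⟩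
    · obtain rfl : i = j := by
        simp only [fanGraph, SimpleGraph.fromRel_adj] at h
        exact h.2.elim id Eq.symm
      exact ⟨e i, (h1 i i.2).1, hge i a, hge i b⟩

lemma ContainsExpansionR.mono {α V : Type*} [DecidableEq V] {r : ℕ} {F : SimpleGraph α}
    {H H' : Finset (Finset V)} (hsub : H' ⊆ H) (h : ContainsExpansionR r F H') :
    ContainsExpansionR r F H := by
  obtain ⟨φ, ψ, h1, h2, h3, h4, h5⟩ := h
  exact ⟨φ, ψ, h1, h2, h3, h4, fun a b hab => hsub (h5 a b hab)⟩

lemma exrFan_le {r t k n m : ℕ} (h : ∀ H : Finset (Finset (Fin n)), (∀ e ∈ H, e.card = r) →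
    ¬ ContainsExpansionR r (fanGraph t k) H → H.card ≤ m) : exrFan r t k n ≤ m := by
  refine csSup_le' ?_
  rintro _ ⟨H, h1, h2, rfl⟩
  exact h H h1 h2

lemma card_le_exrFan {r t k n : ℕ} {H : Finset (Finset (Fin n))} (hr : ∀ e ∈ H, e.card = r)
    (hH : ¬ ContainsExpansionR r (fanGraph t k) H) : H.card ≤ exrFan r t k n := by
  refine le_csSup ⟨Fintype.card (Finset (Fin n)), ?_⟩ ⟨H, hr, hH, rfl⟩
  rintro _ ⟨H', -, -, rfl⟩
  exact Finset.card_le_univ _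

lemma exrFan_le_pow (r t k n : ℕ) : exrFan r t k n ≤ n ^ r := by
  refine exrFan_le fun H hr _ => ?_
  calc H.card ≤ (Finset.powersetCard r (Finset.univ : Finset (Fin n))).card :=
        Finset.card_le_card fun e he => by simp [hr e he]
    _ ≤ n ^ r := by
        rw [Finset.card_powersetCard, Finset.card_univ, Fintype.card_fin]
        exact Nat.choose_le_pow _ _

lemma exrFan_le_mul_pow_pred {r t k : ℕ} (n : ℕ) (hr0 : 0 < r) (hkr : k ≤ r) :
    exrFan r t k n ≤ fanThickness t k r * n ^ (r - 1) := by
  refine exrFan_le fun H hr hH => ?_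
  refine (card_le_of_no_thick (M := fanThickness t k r)
    (Finset.powersetCard (r - 1) Finset.univ) H hr ?_ ?_).trans ?_
  · intro e he x hx
    simp [Finset.card_erase_of_mem hx, hr e he]
  · intro H' hsub hthick
    by_contra hne
    exact hH ((hthick.containsExpansionR_fanGraph (Finset.nonempty_iff_ne_empty.2 hne)
      (fun e he => hr e (hsub he)) hr0 hkr).mono hsub)
  · rw [Finset.card_powersetCard, Finset.card_univ, Fintype.card_fin]
    exact Nat.mul_le_mul_left _ (Nat.choose_le_pow _ _)

/-- The balanced complete `r`-partite `r`-graph contains no expansion of a fan of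
cliques on more than `r` vertices. -/
lemma div_pow_le_exrFan {r t k : ℕ} (n : ℕ) (ht : 1 ≤ t) (hr0 : 0 < r) (hrk : r < k) :
    (n / r) ^ r ≤ exrFan r t k n := by
  classical
  have hlt : ∀ (i : Fin r) (q : Fin (n / r)), r * q.1 + i.1 < n := fun i q => by
    calc r * q.1 + i.1 < r * (q.1 + 1) := by rw [Nat.mul_succ]; exact Nat.add_lt_add_left i.2 _
      _ ≤ r * (n / r) := Nat.mul_le_mul_left _ q.2
      _ ≤ n := Nat.mul_div_le n r
  let vert : (i : Fin r) → Fin (n / r) → Fin n := fun i q => ⟨r * q.1 + i.1, hlt i q⟩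
  have hmod : ∀ i q, (vert i q).1 % r = i.1 := fun i q => by
    simp [vert, Nat.mod_eq_of_lt i.2]
  let edge : (Fin r → Fin (n / r)) → Finset (Fin n) :=
    fun f => Finset.univ.image fun i => vert i (f i)
  have hinj : ∀ f : Fin r → Fin (n / r), Function.Injective fun i => vert i (f i) := by
    intro f i j h
    have := congrArg (fun x : Fin n => x.1 % r) h
    simp only [hmod] at this
    exact Fin.ext this
  have hedge : Function.Injective edge := by
    intro f g h
    funext i
    have hi : vert i (f i) ∈ edge g := h ▸ Finset.mem_image_of_mem _ (Finset.mem_univ i)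
    obtain ⟨j, -, hj⟩ := Finset.mem_image.1 hi
    have hji := congrArg (fun x : Fin n => x.1 % r) hj
    simp only [hmod] at hji
    obtain rfl : j = i := Fin.ext hji
    have := congrArg Fin.val hj
    simp only [vert, Nat.add_right_cancel_iff] at this
    exact Fin.ext (Nat.eq_of_mul_eq_mul_left hr0 this.symm)
  have hcard : (Finset.univ.image edge).card = (n / r) ^ r := by
    rw [Finset.card_image_of_injective _ hedge]
    simp
  rw [← hcard]
  refine card_le_exrFan ?_ ?_
  · intro e he
    obtain ⟨f, -, rfl⟩ := Finset.mem_image.1 he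
    rw [Finset.card_image_of_injective _ (hinj f)]
    simp
  · rintro ⟨φ, ψ, hφ, -, -, -, h⟩
    let core : Option (Fin (k - 1)) → Option (Fin t × Fin (k - 1)) :=
      Option.map fun a => (⟨0, ht⟩, a)
    have hcore : Function.Injective core :=
      Option.map_injective fun a b hab => (Prod.mk.inj hab).2
    obtain ⟨a, b, hab, hcol⟩ := Fintype.exists_ne_map_eq_of_card_lt
      (fun o => (⟨(φ (core o)).1 % r, Nat.mod_lt _ hr0⟩ : Fin r)) (by simp; omega)
    have hadj : (fanGraph t k).Adj (core a) (core b) := by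
      rw [fanGraph, SimpleGraph.fromRel_adj]
      refine ⟨hcore.ne hab, ?_⟩
      rcases a with _ | a <;> rcases b with _ | b <;> simp [core]
    obtain ⟨f, -, hf⟩ := Finset.mem_image.1 (h _ _ hadj)
    have ha : φ (core a) ∈ edge f := by rw [hf]; simp
    have hb : φ (core b) ∈ edge f := by rw [hf]; simp
    obtain ⟨i, -, hi⟩ := Finset.mem_image.1 ha
    obtain ⟨j, -, hj⟩ := Finset.mem_image.1 hb
    rw [Fin.mk.injEq, ← hi, ← hj, hmod, hmod] at hcol
    rw [Fin.ext hcol] at hi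
    exact hcore.ne hab (hφ (hi.symm.trans hj))

/-- A star contains no expansion of a fan of cliques on at least three vertices. -/
lemma choose_le_exrFan {r t k : ℕ} (n : ℕ) (ht : 1 ≤ t) (hk : 3 ≤ k) (hr0 : 0 < r) :
    n.choose (r - 1) ≤ exrFan r t k (n + 1) := by
  classical
  let S : Finset (Finset (Fin (n + 1))) := Finset.powersetCard (r - 1) (Finset.univ.erase 0)
  have hS : ∀ s ∈ S, (0 : Fin (n + 1)) ∉ s ∧ s.card = r - 1 := by
    intro s hs
    rw [Finset.mem_powersetCard] at hs
    exact ⟨fun h => by simpa using hs.1 h, hs.2⟩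
  have hcard : (S.image (insert 0)).card = n.choose (r - 1) := by
    rw [Finset.card_image_of_injOn]
    · simp [S, Finset.card_erase_of_mem]
    · intro s hs s' hs' h
      rw [← Finset.erase_insert (hS s hs).1, h, Finset.erase_insert (hS s' hs').1]
  rw [← hcard]
  refine card_le_exrFan ?_ ?_
  · intro e he
    obtain ⟨s, hs, rfl⟩ := Finset.mem_image.1 he
    rw [Finset.card_insert_of_notMem (hS s hs).1, (hS s hs).2]
    omega
  · rintro ⟨φ, ψ, hφ, -, hran, hdis, h⟩
    let p : Option (Fin t × Fin (k - 1)) := none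
    let q : Option (Fin t × Fin (k - 1)) := some (⟨0, ht⟩, ⟨0, by omega⟩)
    let s : Option (Fin t × Fin (k - 1)) := some (⟨0, ht⟩, ⟨1, by omega⟩)
    have hpq : (fanGraph t k).Adj p q := by simp [fanGraph, p, q]
    have hps : (fanGraph t k).Adj p s := by simp [fanGraph, p, s]
    have hqs : (fanGraph t k).Adj q s := by simp [fanGraph, q, s]
    have hzero : ∀ a b, (fanGraph t k).Adj a b →
        (0 : Fin (n + 1)) = φ a ∨ 0 = φ b ∨ 0 ∈ ψ s(a, b) := by
      intro a b hab
      obtain ⟨f, -, hf⟩ := Finset.mem_image.1 (h a b hab)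
      have h0 : (0 : Fin (n + 1)) ∈ {φ a, φ b} ∪ ψ s(a, b) := hf ▸ Finset.mem_insert_self _ _
      simpa [or_assoc] using h0
    have hnot : ∀ a b, (fanGraph t k).Adj a b → ∀ c, 0 = φ c → c ≠ a → c ≠ b → False := by
      intro a b hab c hc hca hcb
      rcases hzero a b hab with h' | h' | h'
      · exact hca (hφ (hc.symm.trans h'))
      · exact hcb (hφ (hc.symm.trans h'))
      · exact hran _ hab _ h' ⟨c, hc.symm⟩
    rcases hzero p q hpq with h1 | h1 | h1
    · exact hnot q s hqs p h1 hpq.ne hps.ne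
    · exact hnot p s hps q h1 hpq.ne' hqs.ne
    · rcases hzero p s hps with h2 | h2 | h2
      · exact hran _ hpq _ h1 ⟨p, h2.symm⟩
      · exact hran _ hpq _ h1 ⟨s, h2.symm⟩
      · refine Finset.disjoint_left.1 (hdis _ hpq _ hps ?_) h1 h2
        intro heq
        rcases Sym2.eq_iff.1 heq with ⟨-, h3⟩ | ⟨h3, -⟩
        · exact hqs.ne h3
        · exact hps.ne h3

theorem order_of_magnitude_fan_expansion (t k r : ℕ) (ht : 1 ≤ t) (hk : 3 ≤ k) (hr : 2 ≤ r) :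
    (r < k → ∃ c C : ℝ, 0 < c ∧ 0 < C ∧ ∃ N : ℕ, ∀ n ≥ N,
      c * (n : ℝ) ^ r ≤ (exrFan r t k n : ℝ) ∧ (exrFan r t k n : ℝ) ≤ C * (n : ℝ) ^ r) ∧
    (k ≤ r → ∃ c C : ℝ, 0 < c ∧ 0 < C ∧ ∃ N : ℕ, ∀ n ≥ N,
      c * (n : ℝ) ^ (r - 1) ≤ (exrFan r t k n : ℝ) ∧
        (exrFan r t k n : ℝ) ≤ C * (n : ℝ) ^ (r - 1)) := by
  refine ⟨fun hrk => ?_, fun hkr => ?_⟩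
  · have hr0 : (0 : ℝ) < r := by positivity
    refine ⟨(1 / (2 * r)) ^ r, 1, by positivity, one_pos, 2 * r, fun n hn => ⟨?_, ?_⟩⟩
    · have hdiv : 1 / (2 * r) * (n : ℝ) ≤ (n / r : ℕ) := by
        have h1 : n < r * (n / r + 1) := Nat.lt_mul_div_succ n (by omega)
        have h3 : 1 ≤ n / r := (Nat.one_le_div_iff (by omega)).2 (by omega)
        have h2 : n ≤ 2 * r * (n / r) := by nlinarith
        rw [one_div, inv_mul_le_iff₀ (by positivity)]
        exact_mod_cast h2
      rw [← mul_pow]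
      calc (1 / (2 * r) * (n : ℝ)) ^ r ≤ ((n / r : ℕ) : ℝ) ^ r :=
            pow_le_pow_left₀ (by positivity) hdiv r
        _ ≤ exrFan r t k n := by exact_mod_cast div_pow_le_exrFan n ht (by omega) hrk
    · rw [one_mul]
      exact_mod_cast exrFan_le_pow r t k n
  · refine ⟨(1 / 2) ^ (r - 1) / (r - 1).factorial, fanThickness t k r + 1, by positivity,
      by positivity, 2 * r, fun n hn => ⟨?_, ?_⟩⟩
    · obtain ⟨m, rfl⟩ : ∃ m, n = m + 1 := ⟨n - 1, by omega⟩
      have hchoose := Nat.pow_le_choose (r - 1) m (α := ℝ)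
      have hhalf : 1 / 2 * ((m + 1 : ℕ) : ℝ) ≤ (m + 1 - (r - 1) : ℕ) := by
        have : m + 1 ≤ 2 * (m + 1 - (r - 1)) := by omega
        have : ((m + 1 : ℕ) : ℝ) ≤ 2 * (m + 1 - (r - 1) : ℕ) := by exact_mod_cast this
        linarith
      have hpow := pow_le_pow_left₀ (by positivity) hhalf (r - 1)
      rw [mul_pow] at hpow
      have hex : (m.choose (r - 1) : ℝ) ≤ exrFan r t k (m + 1) := by
        exact_mod_cast choose_le_exrFan m ht hk (by omega)
      refine le_trans ?_ (hchoose.trans hex)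
      rw [div_mul_eq_mul_div]
      exact div_le_div_of_nonneg_right hpow (by positivity)
    · have : (exrFan r t k n : ℝ) ≤ fanThickness t k r * (n : ℝ) ^ (r - 1) := by
        exact_mod_cast exrFan_le_mul_pow_pred n (by omega) hkr
      refine this.trans ?_
      gcongr
      linarith
end

section
/- For all integers n ≥ 1, t ≥ 1, k ≥ 3 and r ≥ 2, the generalized Turán numbers satisfy ex(n, K_r, F_{t,k}) ≤ n · ex(n−1, K_{r−1}, tK_{k−1}). -/
/-- `G` contains a subgraph isomorphic to `F`. -/
def ContainsSubgraph {α β : Type*} (F : SimpleGraph α) (G : SimpleGraph β) : Prop :=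
  ∃ f : α → β, Function.Injective f ∧ ∀ a b, F.Adj a b → G.Adj (f a) (f b)

/-- The number of subgraphs of `G` isomorphic to `K_r`, i.e. the number of `r`-cliques. -/
noncomputable def cliqueCount {β : Type*} (G : SimpleGraph β) (r : ℕ) : ℕ :=
  Set.ncard {s : Finset β | G.IsNClique r s}

/-- `tK_{k-1}`: the disjoint union of `t` copies of `K_{k-1}`. -/
def disjCliques (t k : ℕ) : SimpleGraph (Fin t × Fin (k - 1)) :=
  SimpleGraph.fromRel fun x y => x.1 = y.1

/-- The generalized Turán number `ex(n, K_r, F)` for `F`-free graphs on `Fin n`,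
where `F`-freeness is expressed via `ContainsSubgraph`. -/
noncomputable def exClique {α : Type*} (n r : ℕ) (F : SimpleGraph α) : ℕ :=
  sSup {m | ∃ G : SimpleGraph (Fin n), ¬ ContainsSubgraph F G ∧ cliqueCount G r = m}

/-- The link of `v`: the graph induced by `G` on the neighbours of `v`, padded by isolated vertices
so that its vertex set consists of all vertices other than `v`, indexed by `Fin m`. -/
def linkGraph {m : ℕ} (G : SimpleGraph (Fin (m + 1))) (v : Fin (m + 1)) : SimpleGraph (Fin m) where
  Adj a b := G.Adj (v.succAbove a) (v.succAbove b) ∧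
    G.Adj v (v.succAbove a) ∧ G.Adj v (v.succAbove b)
  symm := ⟨fun _ _ h => ⟨h.1.symm, h.2.2, h.2.1⟩⟩
  loopless := ⟨fun _ h => h.1.ne rfl⟩

/-- For `k ≥ 3`, a copy of `tK_{k-1}` in the link of `v` has no isolated vertices, so together
with `v` it spans a fan. -/
theorem containsSubgraph_fanGraph_of_linkGraph {m t k : ℕ} (hk : 3 ≤ k)
    (G : SimpleGraph (Fin (m + 1))) (v : Fin (m + 1))
    (h : ContainsSubgraph (disjCliques t k) (linkGraph G v)) :
    ContainsSubgraph (fanGraph t k) G := by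
  obtain ⟨f, hf, hadj⟩ := h
  have hv : ∀ p, G.Adj v (v.succAbove (f p)) := by
    rintro ⟨i, j⟩
    have : Nontrivial (Fin (k - 1)) := Fin.nontrivial_iff_two_le.2 (by omega)
    obtain ⟨j', hj⟩ := exists_ne j
    exact (hadj (i, j) (i, j') (by simp [disjCliques, hj.symm])).2.1
  refine ⟨fun x => x.elim v fun p => v.succAbove (f p), ?_, ?_⟩
  · rintro (_ | p) (_ | q) hpq
    · rfl
    · exact absurd hpq (hv q).ne
    · exact absurd hpq.symm (hv p).ne
    · exact congrArg some (hf (Fin.succAbove_right_injective hpq))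
  · rintro (_ | p) (_ | q) hpq
    · exact absurd rfl hpq.ne
    · exact hv q
    · exact (hv p).symm
    · refine (hadj p q ?_).1
      simpa [fanGraph, disjCliques] using hpq

/-- Removing `v` from an `r`-clique through `v` leaves an `(r-1)`-clique in the link of `v`. -/
theorem exists_isNClique_linkGraph {m r : ℕ} {G : SimpleGraph (Fin (m + 1))} {v : Fin (m + 1)}
    {s : Finset (Fin (m + 1))} (hs : G.IsNClique r s) (hv : v ∈ s) :
    ∃ T, (linkGraph G v).IsNClique (r - 1) T ∧ insert v (T.map v.succAboveEmb) = s := by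
  have hT : insert v ((Finset.univ.filter fun a => v.succAbove a ∈ s).map v.succAboveEmb) = s := by
    ext x
    rcases Fin.eq_self_or_eq_succAbove v x with rfl | ⟨y, rfl⟩ <;> simp [hv, Fin.succAbove_ne]
  refine ⟨_, ⟨?_, ?_⟩, hT⟩
  · intro a ha b hb hab
    simp only [Finset.coe_filter, Finset.mem_univ, true_and, Set.mem_ofPred_eq] at ha hb
    exact ⟨hs.isClique ha hb (Fin.succAbove_right_injective.ne hab),
      hs.isClique hv ha (Fin.succAbove_ne v a).symm, hs.isClique hv hb (Fin.succAbove_ne v b).symm⟩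
  · have hcard := congrArg Finset.card hT
    rw [Finset.card_insert_of_notMem (by simp [Fin.succAbove_ne]), Finset.card_map,
      hs.card_eq] at hcard
    omega

theorem cliqueCount_le_sum_linkGraph {m r : ℕ} (hr : r ≠ 0) (G : SimpleGraph (Fin (m + 1))) :
    cliqueCount G r ≤ ∑ v, cliqueCount (linkGraph G v) (r - 1) := by
  have hsub : {s | G.IsNClique r s} ⊆ ⋃ v, (fun T => insert v (T.map v.succAboveEmb)) ''
      {T | (linkGraph G v).IsNClique (r - 1) T} := by
    intro s hs
    obtain ⟨v, hv⟩ : s.Nonempty := Finset.card_ne_zero.1 (by rwa [SimpleGraph.IsNClique.card_eq hs])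
    exact Set.mem_iUnion.2 ⟨v, exists_isNClique_linkGraph hs hv⟩
  calc cliqueCount G r ≤ _ := Set.ncard_le_ncard hsub (Set.toFinite _)
    _ ≤ _ := Set.ncard_iUnion_le_of_fintype _
    _ ≤ _ := Finset.sum_le_sum fun v _ => Set.ncard_image_le (Set.toFinite _)

theorem cliqueCount_le_exClique {α : Type*} {n : ℕ} (r : ℕ) {F : SimpleGraph α}
    {G : SimpleGraph (Fin n)} (hG : ¬ ContainsSubgraph F G) :
    cliqueCount G r ≤ exClique n r F :=
  le_csSup (((Set.finite_range fun H : SimpleGraph (Fin n) => cliqueCount H r).subset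
    (by rintro _ ⟨H, _, rfl⟩; exact ⟨H, rfl⟩)).bddAbove) ⟨G, hG, rfl⟩

theorem generalized_turan_fan_recursion (n t k r : ℕ)
    (hn : 1 ≤ n) (ht : 1 ≤ t) (hk : 3 ≤ k) (hr : 2 ≤ r) :
    exClique n r (fanGraph t k) ≤ n * exClique (n - 1) (r - 1) (disjCliques t k) := by
  obtain ⟨m, rfl⟩ := Nat.exists_eq_add_of_le' hn
  refine csSup_le' ?_
  rintro _ ⟨G, hG, rfl⟩
  calc cliqueCount G r ≤ ∑ v, cliqueCount (linkGraph G v) (r - 1) :=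
        cliqueCount_le_sum_linkGraph (by omega) G
    _ ≤ ∑ _v : Fin (m + 1), exClique m (r - 1) (disjCliques t k) :=
        Finset.sum_le_sum fun v _ => cliqueCount_le_exClique _ fun h =>
          hG (containsSubgraph_fanGraph_of_linkGraph hk G v h)
    _ = _ := by simp
end

section
/- For all integers t ≥ 1 and 3 ≤ k ≤ r there exists a constant C such that for all n, ex(n, K_r, F_{t,k}) ≤ C·n^{r−1}. -/
/-- Either a family of finsets of size at most `d` contains `m` pairwise disjoint members, or it
has a transversal of size at most `m * d`. -/
theorem exists_pairwise_disjoint_or_transversal {α : Type*} [DecidableEq α] {d : ℕ}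
    (P : Finset α → Prop) (hP : ∀ A, P A → A.card ≤ d) (m : ℕ) :
    (∃ c : Fin m → Finset α, (∀ i, P (c i)) ∧ ∀ i j, i ≠ j → Disjoint (c i) (c j)) ∨
      ∃ S : Finset α, S.card ≤ m * d ∧ ∀ A, P A → ∃ s ∈ S, s ∈ A := by
  induction m with
  | zero => exact Or.inl ⟨fun i => i.elim0, fun i => i.elim0, fun i => i.elim0⟩
  | succ m ih =>
    rcases ih with ⟨c, hc, hd⟩ | ⟨S, hS, hA⟩
    · by_cases h : ∀ A, P A → ∃ s ∈ Finset.univ.biUnion c, s ∈ A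
      · refine Or.inr ⟨Finset.univ.biUnion c, ?_, h⟩
        have := Finset.card_biUnion_le_card_mul Finset.univ c d fun i _ => hP _ (hc i)
        rw [Finset.card_univ, Fintype.card_fin] at this
        nlinarith
      · push Not at h
        obtain ⟨A, hA, hdis⟩ := h
        have hAc : ∀ i, Disjoint (c i) A := fun i => Finset.disjoint_left.2 fun x hx =>
          hdis x (Finset.mem_biUnion.2 ⟨i, Finset.mem_univ i, hx⟩)
        refine Or.inl ⟨Fin.cons A c, fun i => ?_, fun i j => ?_⟩
        · induction i using Fin.cases with
          | zero => simpa using hA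
          | succ i => simpa using hc i
        · induction i using Fin.cases with
          | zero =>
            induction j using Fin.cases with
            | zero => simp
            | succ j => exact fun _ => by simpa using (hAc j).symm
          | succ i =>
            induction j using Fin.cases with
            | zero => simpa using hAc i
            | succ j => simpa using hd i j
    · exact Or.inr ⟨S, hS.trans (by nlinarith), hA⟩

/-- Pairwise disjoint `(k-1)`-cliques in the neighbourhood of `v` form a fan centred at `v`. -/
theorem containsSubgraph_fanGraph {β : Type*} {G : SimpleGraph β} {t k : ℕ} (v : β)
    (c : Fin t → Finset β) (hc : ∀ i, G.IsNClique (k - 1) (c i))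
    (hv : ∀ i, ∀ b ∈ c i, G.Adj v b) (hd : ∀ i j, i ≠ j → Disjoint (c i) (c j)) :
    ContainsSubgraph (fanGraph t k) G := by
  let e : ∀ i, Fin (k - 1) ≃ c i := fun i => ((c i).equivFinOfCardEq (hc i).card_eq).symm
  let g : Fin t × Fin (k - 1) → β := fun p => e p.1 p.2
  have hg : ∀ p, g p ∈ c p.1 := fun p => (e p.1 p.2).2
  have hinj : Function.Injective g := by
    rintro ⟨i, a⟩ ⟨j, b⟩ h
    have hij : i = j := by
      by_contra hne
      exact Finset.disjoint_left.1 (hd i j hne) (hg (i, a)) (h ▸ hg (j, b))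
    subst hij
    exact congrArg (Prod.mk i) ((e i).injective (Subtype.ext h))
  refine ⟨fun x => x.elim v g, ?_, ?_⟩
  · rintro (_ | p) (_ | q) h
    · rfl
    · exact absurd h (hv _ _ (hg q)).ne
    · exact absurd h.symm (hv _ _ (hg p)).ne
    · exact congrArg some (hinj h)
  · rintro (_ | p) (_ | q) h
    · exact absurd rfl h.ne
    · exact hv _ _ (hg q)
    · exact (hv _ _ (hg p)).symm
    · obtain ⟨hne, h⟩ := (SimpleGraph.fromRel_adj _ _ _).1 h
      have hpq : p.1 = q.1 := h.elim id Eq.symm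
      exact (hc p.1).isClique (hg p) (hpq ▸ hg q) fun h => hne (congrArg some (hinj h))

/-- In a graph without `(t,k)`-fan, boundedly many vertices meet all `r`-cliques through `v` in a
vertex other than `v`. -/
theorem exists_transversal_of_fan_free {β : Type*} [DecidableEq β] {G : SimpleGraph β}
    {t k r : ℕ} (hkr : k ≤ r) (hG : ¬ ContainsSubgraph (fanGraph t k) G) (v : β) :
    ∃ S : Finset β, S.card ≤ t * (k - 1) ∧
      ∀ A, G.IsNClique r A → v ∈ A → ∃ s ∈ S, s ∈ A ∧ s ≠ v := by
  rcases exists_pairwise_disjoint_or_transversal (d := k - 1)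
    (fun B => G.IsNClique (k - 1) B ∧ ∀ b ∈ B, G.Adj v b) (fun B hB => hB.1.card_eq.le) t with
    ⟨c, hc, hd⟩ | ⟨S, hS, h⟩
  · exact absurd (containsSubgraph_fanGraph v c (fun i => (hc i).1) (fun i => (hc i).2) hd) hG
  · refine ⟨S, hS, fun A hA hvA => ?_⟩
    obtain ⟨B, hBA, hB⟩ := Finset.exists_subset_card_eq
      (show k - 1 ≤ (A.erase v).card by rw [Finset.card_erase_of_mem hvA, hA.card_eq]; omega)
    have hmem : ∀ b ∈ B, b ≠ v ∧ b ∈ A := fun b hb => Finset.mem_erase.1 (hBA hb)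
    obtain ⟨s, hsS, hsB⟩ := h B
      ⟨⟨hA.isClique.subset fun b hb => (hmem b hb).2, hB⟩,
        fun b hb => hA.isClique hvA (hmem b hb).2 (hmem b hb).1.symm⟩
    exact ⟨s, hsS, (hmem s hsB).2, (hmem s hsB).1⟩

theorem cliqueCount_le_of_fan_free {n t k r : ℕ} (hr : 2 ≤ r) (hkr : k ≤ r)
    {G : SimpleGraph (Fin n)} (hG : ¬ ContainsSubgraph (fanGraph t k) G) :
    cliqueCount G r ≤ t * (k - 1) * n ^ (r - 1) := by
  choose S hS h using exists_transversal_of_fan_free hkr hG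
  let T : Finset (Finset (Fin n)) := Finset.univ.biUnion fun v => (S v).biUnion fun s =>
    (Finset.univ.powersetCard (r - 2)).image fun B => insert v (insert s B)
  have hsub : {A : Finset (Fin n) | G.IsNClique r A} ⊆ (T : Set (Finset (Fin n))) := by
    intro A hA
    have hA : G.IsNClique r A := hA
    obtain ⟨v, hv⟩ : A.Nonempty := Finset.card_pos.1 (by rw [hA.card_eq]; omega)
    obtain ⟨s, hsS, hsA, hsv⟩ := h v A hA hv
    have hs : s ∈ A.erase v := Finset.mem_erase.2 ⟨hsv, hsA⟩
    simp only [T, Finset.mem_coe, Finset.mem_biUnion, Finset.mem_image,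
      Finset.mem_powersetCard, Finset.mem_univ, true_and, Finset.subset_univ]
    refine ⟨v, s, hsS, (A.erase v).erase s, ?_, ?_⟩
    · rw [Finset.card_erase_of_mem hs, Finset.card_erase_of_mem hv, hA.card_eq]
      omega
    · rw [Finset.insert_erase hs, Finset.insert_erase hv]
  have hT : T.card ≤ n * (t * (k - 1) * n ^ (r - 2)) := by
    refine (Finset.card_biUnion_le_card_mul _ _ (t * (k - 1) * n ^ (r - 2)) fun v _ => ?_).trans
      (by rw [Finset.card_univ, Fintype.card_fin])
    refine (Finset.card_biUnion_le_card_mul _ _ (n ^ (r - 2)) fun s _ => ?_).trans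
      (Nat.mul_le_mul_right _ (hS v))
    refine Finset.card_image_le.trans ?_
    rw [Finset.card_powersetCard, Finset.card_univ, Fintype.card_fin]
    exact Nat.choose_le_pow n (r - 2)
  calc cliqueCount G r ≤ T.card := by
        rw [← Set.ncard_coe_finset]
        exact Set.ncard_le_ncard hsub T.finite_toSet
    _ ≤ n * (t * (k - 1) * n ^ (r - 2)) := hT
    _ = t * (k - 1) * n ^ (r - 1) := by
        rw [show r - 1 = r - 2 + 1 by omega, pow_succ]
        ring

theorem generalized_turan_fan_upper (t k r : ℕ) (ht : 1 ≤ t) (hk : 3 ≤ k) (hkr : k ≤ r) :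
    ∃ C : ℝ, ∀ n : ℕ, (exClique n r (fanGraph t k) : ℝ) ≤ C * (n : ℝ) ^ (r - 1) := by
  refine ⟨(t * (k - 1) : ℕ), fun n => ?_⟩
  have h : exClique n r (fanGraph t k) ≤ t * (k - 1) * n ^ (r - 1) := by
    refine csSup_le' ?_
    rintro m ⟨G, hG, rfl⟩
    exact cliqueCount_le_of_fan_free (by omega) hkr hG
  exact_mod_cast h
end

section
/- For all integers t > 1 and r ≥ 3 there exists a constant C such that for all n, |ex_r(n, F(t,r)) − t·C(n, r−1)| ≤ C·n^{r−2}. -/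
/-- The `r`-graph `H` contains a copy of `F(t,r)`: `t` copies of the complete
`(r-1)`-uniform hypergraph `K_r^{(r-1)}` sharing exactly one common vertex `c`
(the `i`-th copy has vertex set `insert c (A i)`), with each of the `t*r`
hyperedges (the `(r-1)`-subsets of the vertex sets of the copies) enlarged by a
new vertex `ν (i, s)`, the new vertices being pairwise distinct and distinct
from the vertices of the copies. -/
def ContainsFtr {V : Type*} [DecidableEq V] (t r : ℕ) (H : Finset (Finset V)) : Prop :=
  ∃ (c : V) (A : Fin t → Finset V) (ν : Fin t × Finset V → V),
    (∀ i, (A i).card = r - 1) ∧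
    (∀ i, c ∉ A i) ∧
    (Pairwise fun i j => Disjoint (A i) (A j)) ∧
    (∀ i, ∀ s ∈ (insert c (A i)).powersetCard (r - 1),
      ν (i, s) ≠ c ∧ ∀ j, ν (i, s) ∉ A j) ∧
    Set.InjOn ν {p : Fin t × Finset V | p.2 ∈ (insert c (A p.1)).powersetCard (r - 1)} ∧
    (∀ i, ∀ s ∈ (insert c (A i)).powersetCard (r - 1), insert (ν (i, s)) s ∈ H)

/-- The Turán number `ex_r(n, F(t,r))`. -/
noncomputable def exrFtr (t r n : ℕ) : ℕ :=
  sSup {m | ∃ H : Finset (Finset (Fin n)),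
    (∀ e ∈ H, e.card = r) ∧ ¬ ContainsFtr t r H ∧ H.card = m}

open Finset in
/-- A family of sets of size at most `k` contains `t` pairwise disjoint members or has a cover of
size at most `t * k`. -/
theorem exists_pairwise_disjoint_or_cover {V : Type*} [DecidableEq V] (L : Finset (Finset V))
    (k : ℕ) (hk : ∀ e ∈ L, e.card ≤ k) (t : ℕ) :
    (∃ A : Fin t → Finset V, (∀ i, A i ∈ L) ∧ Pairwise fun i j => Disjoint (A i) (A j)) ∨
      ∃ U : Finset V, U.card ≤ t * k ∧ ∀ e ∈ L, ∃ x ∈ e, x ∈ U := by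
  induction t with
  | zero => exact Or.inl ⟨fun i => i.elim0, fun i => i.elim0, fun i => i.elim0⟩
  | succ t ih =>
    rcases ih with ⟨A, hA, hd⟩ | ⟨U, hU, hc⟩
    · by_cases h : ∀ e ∈ L, ∃ x ∈ e, x ∈ univ.biUnion A
      · refine Or.inr ⟨univ.biUnion A, ?_, h⟩
        have := card_biUnion_le_card_mul univ A k fun i _ => hk _ (hA i)
        rw [card_univ, Fintype.card_fin] at this
        exact this.trans (Nat.mul_le_mul_right _ (Nat.le_succ t))
      · push Not at h
        obtain ⟨B, hB, hBA⟩ := h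
        have hdisj : ∀ i, Disjoint B (A i) := fun i => disjoint_left.2 fun x hx hxi =>
          hBA x hx (mem_biUnion.2 ⟨i, mem_univ i, hxi⟩)
        refine Or.inl ⟨Fin.cons B A, fun i => ?_, fun i j hij => ?_⟩
        · refine Fin.cases ?_ (fun i => ?_) i
          · simpa using hB
          · simpa using hA i
        · revert hij
          refine Fin.cases ?_ (fun i => ?_) i <;> refine Fin.cases ?_ (fun j => ?_) j
          · simp
          · simpa using fun _ => hdisj j
          · simpa using (hdisj i).symm
          · intro hij
            simpa using hd fun h => hij (by rw [h])
    · exact Or.inr ⟨U, hU.trans (Nat.mul_le_mul_right _ (Nat.le_succ t)), hc⟩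

/-- A fixed-point-free self-map of a set of at least three points has two distinct values `u`, `v`
such that `u` is the image of a point other than `v`. -/
theorem exists_two_values_of_no_fixed_point {V : Type*} [DecidableEq V] (e : Finset V)
    (he : 3 ≤ e.card) (φ : V → V) (hφ : ∀ x ∈ e, φ x ∈ e) (hne : ∀ x ∈ e, φ x ≠ x) :
    ∃ w ∈ e, ∃ x ∈ e, φ w ≠ φ x ∧ w ≠ φ x := by
  by_cases h : ∃ w ∈ e, φ (φ w) ≠ w
  · obtain ⟨w, hw, hww⟩ := h
    exact ⟨w, hw, φ w, hφ w hw, (hne _ (hφ w hw)).symm, hww.symm⟩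
  · push Not at h
    obtain ⟨w, hw⟩ : e.Nonempty := Finset.card_pos.1 (by omega)
    obtain ⟨x, hx, hxn⟩ := Finset.exists_mem_notMem_of_card_lt_card
      (s := {w, φ w}) (t := e) (Finset.card_le_two.trans_lt he)
    simp only [Finset.mem_insert, Finset.mem_singleton, not_or] at hxn
    refine ⟨w, hw, x, hx, fun hh => hxn.1 ?_, fun hh => hxn.2 ?_⟩
    · rw [← h x hx, ← hh, h w hw]
    · rw [hh, h x hx]

open Finset in
/-- An `r`-graph without `t` edges pairwise meeting exactly in a common vertex has
`O(n ^ (r - 2))` edges. -/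
theorem card_le_of_no_sunflower {V : Type*} [Fintype V] [DecidableEq V] (t r : ℕ) (hr : 3 ≤ r)
    (G : Finset (Finset V)) (hG : ∀ e ∈ G, e.card = r)
    (hfree : ¬ ∃ (c : V) (A : Fin t → Finset V), (∀ i, c ∉ A i) ∧ (∀ i, insert c (A i) ∈ G) ∧
      Pairwise fun i j => Disjoint (A i) (A j)) :
    G.card ≤ (r * (t * r)) ^ 2 * Fintype.card V ^ (r - 2) := by
  have hcov : ∀ c : V, ∃ U : Finset V, U.card ≤ t * r ∧
      ∀ e ∈ G, c ∈ e → ∃ x ∈ e, x ≠ c ∧ x ∈ U := by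
    intro c
    rcases exists_pairwise_disjoint_or_cover ((G.filter (c ∈ ·)).image (·.erase c)) r
      (by
        intro e he
        obtain ⟨e', he', rfl⟩ := mem_image.1 he
        exact (card_erase_le).trans (hG _ (mem_filter.1 he').1).le) t with ⟨A, hA, hd⟩ | ⟨U, hU, hc⟩
    · refine absurd ⟨c, A, fun i => ?_, fun i => ?_, hd⟩ hfree
      · obtain ⟨e, -, he⟩ := mem_image.1 (hA i)
        simp [← he]
      · obtain ⟨e, he, hei⟩ := mem_image.1 (hA i)
        rw [← hei, insert_erase (mem_filter.1 he).2]
        exact (mem_filter.1 he).1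
    · refine ⟨U, hU, fun e he hce => ?_⟩
      obtain ⟨x, hx, hxU⟩ := hc _ (mem_image_of_mem _ (mem_filter.2 ⟨he, hce⟩))
      exact ⟨x, mem_of_mem_erase hx, ne_of_mem_erase hx, hxU⟩
  choose T hTc hT using hcov
  have hsub : G ⊆ (powersetCard (r - 2) univ).biUnion fun S => (S.biUnion T).biUnion fun u =>
      ((insert u S).biUnion T).image fun v => insert v (insert u S) := by
    intro e he
    have : ∀ x, ∃ y, x ∈ e → y ∈ e ∧ y ≠ x ∧ y ∈ T x := fun x => by
      by_cases hx : x ∈ e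
      · obtain ⟨y, hy⟩ := hT x e he hx
        exact ⟨y, fun _ => hy⟩
      · exact ⟨x, fun h => absurd h hx⟩
    choose φ hφ using this
    obtain ⟨w, hw, x, hx, hne, hwx⟩ := exists_two_values_of_no_fixed_point e
      (by rw [hG e he]; exact hr) φ (fun x hx => (hφ x hx).1) (fun x hx => (hφ x hx).2.1)
    have hu := hφ w hw
    have hv := hφ x hx
    have h2 : insert (φ w) ((e.erase (φ x)).erase (φ w)) = e.erase (φ x) :=
      insert_erase (mem_erase.2 ⟨hne, hu.1⟩)
    refine mem_biUnion.2 ⟨(e.erase (φ x)).erase (φ w), ?_, mem_biUnion.2 ⟨φ w,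
      mem_biUnion.2 ⟨w, ?_, hu.2.2⟩, mem_image.2 ⟨φ x, mem_biUnion.2 ⟨x, ?_, hv.2.2⟩, ?_⟩⟩⟩
    · rw [mem_powersetCard_univ, card_erase_of_mem (mem_erase.2 ⟨hne, hu.1⟩),
        card_erase_of_mem hv.1, hG e he]
      omega
    · exact mem_erase.2 ⟨hu.2.1.symm, mem_erase.2 ⟨hwx, hw⟩⟩
    · rw [h2]
      exact mem_erase.2 ⟨hv.2.1.symm, hx⟩
    · rw [h2, insert_erase hv.1]
  have hbi : ∀ S : Finset V, S.card ≤ r → (S.biUnion T).card ≤ r * (t * r) := fun S hS =>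
    (card_biUnion_le_card_mul S T _ fun c _ => hTc c).trans (Nat.mul_le_mul_right _ hS)
  refine (card_le_card hsub).trans ((card_biUnion_le_card_mul _ _ ((r * (t * r)) ^ 2) ?_).trans ?_)
  · intro S hS
    rw [mem_powersetCard_univ] at hS
    refine (card_biUnion_le_card_mul _ _ (r * (t * r)) fun u _ => ?_).trans ?_
    · refine card_image_le.trans (hbi _ ((card_insert_le _ _).trans ?_))
      omega
    · rw [sq]
      exact Nat.mul_le_mul_right _ (hbi S (by omega))
  · rw [card_powersetCard, card_univ, mul_comm]
    exact Nat.mul_le_mul_left _ (Nat.choose_le_pow _ _)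

open Finset in
/-- If each member `e` of `G` comes with a set `B e` of size at most `b` disjoint from `e`, then a
positive proportion of `G` lies inside a set `W` disjoint from all the corresponding `B e`. -/
theorem exists_restriction {V : Type*} [Fintype V] [DecidableEq V] (r b : ℕ)
    (G : Finset (Finset V)) (hG : ∀ e ∈ G, e.card = r) (B : Finset V → Finset V)
    (hB : ∀ e ∈ G, (B e).card ≤ b) (hd : ∀ e ∈ G, Disjoint e (B e)) :
    ∃ W : Finset V, G.card ≤ 2 ^ (r + b) * (G.filter fun e => e ⊆ W ∧ Disjoint (B e) W).card := by
  by_contra! hcon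
  have hcount : ∀ e ∈ G, 2 ^ Fintype.card V ≤
      2 ^ (r + b) * ((univ : Finset (Finset V)).filter fun W => e ⊆ W ∧ Disjoint (B e) W).card := by
    intro e he
    have hsub : Icc e (B e)ᶜ ⊆
        (univ : Finset (Finset V)).filter fun W => e ⊆ W ∧ Disjoint (B e) W := by
      intro W hW
      rw [mem_Icc] at hW
      exact mem_filter.2 ⟨mem_univ _, hW.1, (le_compl_iff_disjoint_left.1 hW.2)⟩
    have hle : e ⊆ (B e)ᶜ := le_compl_iff_disjoint_right.2 (hd e he)
    have hc := card_le_card hsub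
    rw [card_Icc_finset hle, card_compl, hG e he] at hc
    refine le_trans ?_ (Nat.mul_le_mul_left _ hc)
    rw [← pow_add]
    refine Nat.pow_le_pow_right two_pos ?_
    have := hB e he
    omega
  have h1 : G.card * 2 ^ Fintype.card V ≤ 2 ^ (r + b) *
      ∑ e ∈ G, ((univ : Finset (Finset V)).filter fun W => e ⊆ W ∧ Disjoint (B e) W).card := by
    rw [mul_sum, ← smul_eq_mul (a := G.card)]
    exact card_nsmul_le_sum _ _ _ hcount
  have h2 : ∑ e ∈ G, ((univ : Finset (Finset V)).filter fun W => e ⊆ W ∧ Disjoint (B e) W).card =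
      ∑ W : Finset V, (G.filter fun e => e ⊆ W ∧ Disjoint (B e) W).card := by
    simp_rw [card_filter]
    exact sum_comm
  have h3 : 2 ^ (r + b) * ∑ W : Finset V, (G.filter fun e => e ⊆ W ∧ Disjoint (B e) W).card <
      ∑ _W : Finset V, G.card := by
    rw [mul_sum]
    exact sum_lt_sum_of_nonempty univ_nonempty fun W _ => hcon W
  rw [sum_const, card_univ, Fintype.card_finset, smul_eq_mul, mul_comm (2 ^ Fintype.card V)] at h3
  rw [h2] at h1
  exact h1.not_gt h3

open Finset in
/-- Double counting: edges whose facets have small total inverse degree account for the excess of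
`|H|` over `t` times the number of `k`-sets. -/
theorem card_le_add_card_light {V : Type*} [Fintype V] [DecidableEq V] (t k : ℕ)
    (H : Finset (Finset V)) :
    H.card ≤ t * (Fintype.card V).choose k + (H.filter fun e =>
      (t : ℚ) * ∑ f ∈ e.powersetCard k, ((H.filter (f ⊆ ·)).card : ℚ)⁻¹ < 1).card := by
  set w : Finset V → ℚ := fun e => ∑ f ∈ e.powersetCard k, ((H.filter (f ⊆ ·)).card : ℚ)⁻¹ with hw
  have hw0 : ∀ e, 0 ≤ w e := fun e => sum_nonneg fun f _ => by positivity
  have hsum : ∑ e ∈ H, w e ≤ (Fintype.card V).choose k := by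
    have hpt : ∀ e, w e = ∑ f ∈ powersetCard k univ,
        if f ⊆ e then ((H.filter (f ⊆ ·)).card : ℚ)⁻¹ else 0 := by
      intro e
      rw [← sum_filter, hw]
      refine sum_congr ?_ fun _ _ => rfl
      ext f
      simp [mem_powersetCard, and_comm]
    simp_rw [hpt]
    rw [sum_comm]
    refine (sum_le_card_nsmul _ _ 1 fun f _ => ?_).trans (by simp)
    rw [← sum_filter, sum_const, nsmul_eq_mul]
    exact mul_inv_le_one
  have hedge : ∀ e ∈ H, (1 : ℚ) ≤ t * w e + if t * w e < 1 then 1 else 0 := by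
    intro e _
    have := mul_nonneg (Nat.cast_nonneg (α := ℚ) t) (hw0 e)
    split_ifs <;> linarith
  have h1 := sum_le_sum hedge
  rw [sum_add_distrib, ← mul_sum, ← sum_filter] at h1
  simp only [sum_const, nsmul_eq_mul, mul_one] at h1
  have h2 := mul_le_mul_of_nonneg_left hsum (Nat.cast_nonneg (α := ℚ) t)
  have h3 : (H.card : ℚ) ≤ t * (Fintype.card V).choose k +
      (H.filter fun e => t * w e < 1).card := by linarith
  exact_mod_cast h3

open Finset in
/-- A facet `f` of an edge `e` extends to edges other than `e` by as many vertices outside `e`. -/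
theorem card_le_card_extensions {V : Type*} [Fintype V] [DecidableEq V] (r : ℕ) (hr : 1 ≤ r)
    (H : Finset (Finset V)) (hH : ∀ e ∈ H, e.card = r) (e : Finset V) (he : e ∈ H)
    (f : Finset V) (hf : f ∈ e.powersetCard (r - 1)) :
    (H.filter (f ⊆ ·)).card ≤ (univ.filter fun v => v ∉ e ∧ insert v f ∈ H).card + 1 := by
  rw [mem_powersetCard] at hf
  have hsub : (H.filter (f ⊆ ·)).erase e ⊆
      (univ.filter fun v => v ∉ e ∧ insert v f ∈ H).image (insert · f) := by
    intro e' he'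
    rw [mem_erase, mem_filter] at he'
    obtain ⟨hne, he'H, hfe'⟩ := he'
    obtain ⟨v, hv⟩ : ∃ v, e' \ f = {v} := by
      rw [← card_eq_one, card_sdiff_of_subset hfe', hH _ he'H, hf.2]
      omega
    have hins : insert v f = e' := by
      rw [insert_eq, ← hv, sdiff_union_of_subset hfe']
    refine mem_image.2 ⟨v, mem_filter.2 ⟨mem_univ _, fun hve => hne ?_, hins ▸ he'H⟩, hins⟩
    refine eq_of_subset_of_card_le ?_ (by rw [hH _ he, hH _ he'H])
    rw [← hins]
    exact insert_subset hve hf.1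
  have h1 := (card_le_card hsub).trans card_image_le
  have h2 := pred_card_le_card_erase (s := H.filter (f ⊆ ·)) (a := e)
  omega

open Finset in
/-- A common vertex, disjoint petals and small candidate sets for the expansion vertices, subject to
a Hall-type condition in each petal, yield a copy of `F(t,r)`. -/
theorem containsFtr_of_candidates {V : Type*} [DecidableEq V] (t r : ℕ)
    (H : Finset (Finset V)) (c : V) (A : Fin t → Finset V) (N : Finset V → Finset V → Finset V)
    (hcard : ∀ i, (A i).card = r - 1) (hc : ∀ i, c ∉ A i)
    (hd : Pairwise fun i j => Disjoint (A i) (A j))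
    (hN : ∀ i, ∀ s ∈ (insert c (A i)).powersetCard (r - 1), ∀ v ∈ N (insert c (A i)) s,
      (∀ j, v ∉ insert c (A j)) ∧ insert v s ∈ H)
    (hall : ∀ i, ∀ D ⊆ (insert c (A i)).powersetCard (r - 1), D.Nonempty →
      ∃ s ∈ D, t * D.card ≤ (N (insert c (A i)) s).card) :
    ContainsFtr t r H := by
  let ι := {p : Fin t × Finset V // p.2 ∈ (insert c (A p.1)).powersetCard (r - 1)}
  obtain ⟨f, hfinj, hf⟩ := (all_card_le_biUnion_card_iff_exists_injective
    (fun p : ι => N (insert c (A p.1.1)) p.1.2)).1 (by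
      intro Q
      rcases Q.eq_empty_or_nonempty with rfl | ⟨q, hq⟩
      · simp
      obtain ⟨i, -, hi⟩ := exists_max_image univ (fun i : Fin t => (Q.filter fun p => p.1.1 = i).card)
        ⟨q.1.1, mem_univ _⟩
      have hQ : Q.card ≤ t * (Q.filter fun p => p.1.1 = i).card := by
        rw [card_eq_sum_card_fiberwise (f := fun p : ι => p.1.1) (t := univ)
          (fun _ _ => mem_coe.2 (mem_univ _))]
        refine (sum_le_card_nsmul _ _ _ hi).trans ?_
        simp
      set D := (Q.filter fun p => p.1.1 = i).image fun p => p.1.2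
      have hDc : D.card = (Q.filter fun p => p.1.1 = i).card := by
        refine card_image_of_injOn fun p hp p' hp' h => ?_
        exact Subtype.ext (Prod.ext ((mem_filter.1 hp).2.trans (mem_filter.1 hp').2.symm) h)
      obtain ⟨s, hs, hsc⟩ := hall i D (by
          intro s hs
          obtain ⟨p, hp, rfl⟩ := mem_image.1 hs
          rw [← (mem_filter.1 hp).2]
          exact p.2) (by
          rw [← card_pos, hDc]
          have := card_pos.2 ⟨q, hq⟩
          exact Nat.pos_of_mul_pos_left (this.trans_le hQ))
      obtain ⟨p, hp, rfl⟩ := mem_image.1 hs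
      rw [mem_filter] at hp
      rw [hDc] at hsc
      refine hQ.trans (hsc.trans (card_le_card ?_))
      rw [← hp.2]
      exact subset_biUnion_of_mem (fun p : ι => N (insert c (A p.1.1)) p.1.2) hp.1)
  let ν : Fin t × Finset V → V := fun p =>
    if h : p.2 ∈ (insert c (A p.1)).powersetCard (r - 1) then f ⟨p, h⟩ else c
  have hν : ∀ p (h : p.2 ∈ (insert c (A p.1)).powersetCard (r - 1)), ν p = f ⟨p, h⟩ :=
    fun p h => dif_pos h
  refine ⟨c, A, ν, hcard, hc, hd, fun i s hs => ?_, fun p hp q hq hpq => ?_, fun i s hs => ?_⟩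
  · rw [hν (i, s) hs]
    have := (hN i s hs _ (hf ⟨(i, s), hs⟩)).1
    exact ⟨fun h => this i (mem_insert.2 (Or.inl h)), fun j h => this j (mem_insert_of_mem h)⟩
  · rw [hν p hp, hν q hq] at hpq
    exact congrArg Subtype.val (hfinj hpq)
  · rw [hν (i, s) hs]
    exact (hN i s hs _ (hf ⟨(i, s), hs⟩)).2

open Finset in
/-- In a light edge, every nonempty set of facets contains one of large degree. -/
theorem exists_facet_of_light {V : Type*} (t : ℕ) (ht : 0 < t) (d : Finset V → ℕ)
    (P D : Finset (Finset V)) (hD : D ⊆ P) (hne : D.Nonempty) (hd : ∀ f ∈ P, 0 < d f)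
    (hlight : (t : ℚ) * ∑ f ∈ P, (d f : ℚ)⁻¹ < 1) :
    ∃ s ∈ D, t * D.card < d s := by
  by_contra! hcon
  have hDpos : (0 : ℚ) < D.card := by exact_mod_cast card_pos.2 hne
  have htpos : (0 : ℚ) < t := by exact_mod_cast ht
  have h1 : ∑ f ∈ D, ((t * D.card : ℕ) : ℚ)⁻¹ ≤ ∑ f ∈ D, (d f : ℚ)⁻¹ :=
    sum_le_sum fun f hf => inv_anti₀ (by exact_mod_cast hd f (hD hf)) (by exact_mod_cast hcon f hf)
  have h2 : ∑ f ∈ D, (d f : ℚ)⁻¹ ≤ ∑ f ∈ P, (d f : ℚ)⁻¹ :=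
    sum_le_sum_of_subset_of_nonneg hD fun f _ _ => by positivity
  have h3 : (t : ℚ) * ∑ f ∈ D, ((t * D.card : ℕ) : ℚ)⁻¹ = 1 := by
    rw [sum_const, nsmul_eq_mul]
    push_cast
    field_simp
  have := mul_le_mul_of_nonneg_left (h1.trans h2) htpos.le
  linarith

open Finset in
theorem card_le_of_not_containsFtr {V : Type*} [Fintype V] [DecidableEq V] (t r : ℕ) (ht : 1 < t)
    (hr : 3 ≤ r) (H : Finset (Finset V)) (hH : ∀ e ∈ H, e.card = r) (hF : ¬ ContainsFtr t r H) :
    H.card ≤ t * (Fintype.card V).choose (r - 1) +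
      2 ^ (r + r * (t * r)) * (r * (t * r)) ^ 2 * Fintype.card V ^ (r - 2) := by
  refine (card_le_add_card_light t (r - 1) H).trans (Nat.add_le_add_left ?_ _)
  set G := H.filter fun e =>
      (t : ℚ) * ∑ f ∈ e.powersetCard (r - 1), ((H.filter (f ⊆ ·)).card : ℚ)⁻¹ < 1
  have hGH : ∀ e ∈ G, e ∈ H := fun e he => (mem_filter.1 he).1
  have hcand : ∀ e f : Finset V, ∃ N ⊆ univ.filter fun v => v ∉ e ∧ insert v f ∈ H,
      N.card = min (univ.filter fun v => v ∉ e ∧ insert v f ∈ H).card (t * r) := fun e f =>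
    exists_subset_card_eq (min_le_left _ _)
  choose N hNsub hNcard using hcand
  have hfac : ∀ e ∈ G, (e.powersetCard (r - 1)).card = r := fun e he => by
    rw [card_powersetCard, hH e (hGH e he), Nat.choose_symm (by omega : 1 ≤ r), Nat.choose_one_right]
  set B : Finset V → Finset V := fun e => (e.powersetCard (r - 1)).biUnion (N e)
  obtain ⟨W, hW⟩ := exists_restriction r (r * (t * r)) G (fun e he => hH e (hGH e he)) B
    (fun e he => by
      refine (card_biUnion_le_card_mul _ _ (t * r) fun f _ => ?_).trans (by rw [hfac e he])
      rw [hNcard]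
      exact min_le_right _ _)
    (fun e _ => by
      refine disjoint_left.2 fun v hv hvB => ?_
      obtain ⟨f, -, hvf⟩ := mem_biUnion.1 hvB
      exact (mem_filter.1 (hNsub e f hvf)).2.1 hv)
  refine hW.trans ?_
  rw [mul_assoc]
  refine Nat.mul_le_mul_left _ (card_le_of_no_sunflower t r hr _
    (fun e he => hH e (hGH e (mem_filter.1 he).1)) ?_)
  rintro ⟨c, A, hc, hA, hd⟩
  have hAG : ∀ i, insert c (A i) ∈ G := fun i => (mem_filter.1 (hA i)).1
  have hAW : ∀ i, insert c (A i) ⊆ W := fun i => (mem_filter.1 (hA i)).2.1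
  refine hF (containsFtr_of_candidates t r H c A N (fun i => ?_) hc hd (fun i s hs v hv => ⟨?_, ?_⟩)
    fun i D hD hne => ?_)
  · have := hH _ (hGH _ (hAG i))
    rw [card_insert_of_notMem (hc i)] at this
    omega
  · intro j hj
    exact disjoint_left.1 (mem_filter.1 (hA i)).2.2 (mem_biUnion.2 ⟨s, hs, hv⟩) (hAW j hj)
  · exact (mem_filter.1 (hNsub _ s hv)).2.2
  · obtain ⟨s, hs, hlt⟩ := exists_facet_of_light t (by omega) (fun f => (H.filter (f ⊆ ·)).card)
      _ D hD hne (fun f hf => card_pos.2 ⟨_, mem_filter.2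
        ⟨hGH _ (hAG i), (mem_powersetCard.1 hf).1⟩⟩) (mem_filter.1 (hAG i)).2
    refine ⟨s, hs, ?_⟩
    have h1 := card_le_card_extensions r (by omega) H hH _ (hGH _ (hAG i)) s (hD hs)
    have h2 := card_le_card hD
    rw [hfac _ (hAG i)] at h2
    rw [hNcard]
    refine le_min ?_ (Nat.mul_le_mul_left _ h2)
    omega

open Finset in
/-- No `t`-set meets all edges of a copy of `F(t,r)`. -/
theorem not_containsFtr_of_cover {V : Type*} [DecidableEq V] (t r : ℕ) (ht : 1 < t) (hr : 3 ≤ r)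
    (H : Finset (Finset V)) (T : Finset V) (hT : T.card = t)
    (hcov : ∀ e ∈ H, ∃ x ∈ e, x ∈ T) : ¬ ContainsFtr t r H := by
  rintro ⟨c, A, ν, hcard, hc, hd, hν, hinj, hmem⟩
  have hAf : ∀ i, A i ∈ (insert c (A i)).powersetCard (r - 1) := fun i =>
    mem_powersetCard.2 ⟨subset_insert _ _, hcard i⟩
  have hpick : ∀ i, ∃ x ∈ insert (ν (i, A i)) (A i), x ∈ T := fun i => hcov _ (hmem i _ (hAf i))
  choose τ hτ hτT using hpick
  have hτc : ∀ i, τ i ≠ c := by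
    intro i h
    rcases mem_insert.1 (hτ i) with h' | h'
    · exact (hν i _ (hAf i)).1 (h' ▸ h)
    · exact hc i (h ▸ h')
  have hsep : ∀ i j, i ≠ j → ∀ s ∈ (insert c (A i)).powersetCard (r - 1),
      ∀ x ∈ insert (ν (i, s)) s, x ≠ c → x ≠ τ j := by
    rintro i j hij s hs x hx hxc rfl
    have hxA : τ j ∈ s → τ j ∈ A i := fun h =>
      (mem_insert.1 ((mem_powersetCard.1 hs).1 h)).resolve_left hxc
    rcases mem_insert.1 hx with h | h <;> rcases mem_insert.1 (hτ j) with h' | h'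
    · have := hinj hs (hAf j) (h.symm.trans h')
      exact hij (congrArg Prod.fst this)
    · exact (hν i s hs).2 j (h ▸ h')
    · exact (hν j _ (hAf j)).2 i (h' ▸ hxA h)
    · exact disjoint_left.1 (hd hij) (hxA h) h'
  have hτinj : Function.Injective τ := fun i j h => by
    by_contra hij
    exact hsep i j hij _ (hAf i) _ (hτ i) (hτc i) h
  have himg : univ.image τ = T := by
    refine eq_of_subset_of_card_le (image_subset_iff.2 fun i _ => hτT i) ?_
    rw [card_image_of_injective _ hτinj, card_univ, Fintype.card_fin, hT]
  have hcT : c ∉ T := by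
    rw [← himg]
    intro h
    obtain ⟨i, -, hi⟩ := mem_image.1 h
    exact hτc i hi
  let i₀ : Fin t := ⟨0, by omega⟩
  obtain ⟨a, haA, ha⟩ : ∃ a ∈ A i₀, τ i₀ ∈ A i₀ → τ i₀ = a := by
    by_cases h : τ i₀ ∈ A i₀
    · exact ⟨_, h, fun _ => rfl⟩
    · obtain ⟨a, ha⟩ : (A i₀).Nonempty := card_pos.1 (by rw [hcard]; omega)
      exact ⟨a, ha, fun h' => absurd h' h⟩
  have hs : (insert c (A i₀)).erase a ∈ (insert c (A i₀)).powersetCard (r - 1) := by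
    refine mem_powersetCard.2 ⟨erase_subset _ _, ?_⟩
    rw [card_erase_of_mem (mem_insert_of_mem haA), card_insert_of_notMem (hc i₀), hcard]
    omega
  obtain ⟨x, hx, hxT⟩ := hcov _ (hmem i₀ _ hs)
  have hxc : x ≠ c := fun h => hcT (h ▸ hxT)
  rw [← himg] at hxT
  obtain ⟨j, -, rfl⟩ := mem_image.1 hxT
  by_cases hj : i₀ = j
  · subst hj
    rcases mem_insert.1 hx with h | h
    · rcases mem_insert.1 (hτ i₀) with h' | h'
      · have := congrArg Prod.snd (hinj hs (hAf i₀) (h.symm.trans h'))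
        simp only at this
        exact notMem_erase a _ (this ▸ haA)
      · exact (hν i₀ _ hs).2 i₀ (h ▸ h')
    · rw [mem_erase] at h
      exact h.1 (ha ((mem_insert.1 h.2).resolve_left hxc))
  · exact hsep i₀ j hj _ hs _ hx hxc rfl

theorem choose_add_mul_choose_le (m k t : ℕ) :
    m.choose (k + 1) + t * m.choose k ≤ (m + t).choose (k + 1) := by
  induction t with
  | zero => simp
  | succ t ih =>
    rw [← add_assoc, Nat.choose_succ_succ]
    have := Nat.choose_le_choose k (Nat.le_add_right m t)
    linarith

theorem choose_le_choose_add_mul_choose (m k t : ℕ) :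
    (m + t).choose (k + 1) ≤ m.choose (k + 1) + t * (m + t).choose k := by
  induction t with
  | zero => simp
  | succ t ih =>
    have h := Nat.choose_le_choose k (Nat.le_succ (m + t))
    have h' := Nat.mul_le_mul_left t h
    rw [← add_assoc, Nat.choose_succ_succ (m + t) k]
    rw [Nat.succ_eq_add_one] at h h'
    linarith

open Finset in
theorem exists_large_not_containsFtr (t r n : ℕ) (ht : 1 < t) (hr : 3 ≤ r) :
    ∃ H : Finset (Finset (Fin n)), (∀ e ∈ H, e.card = r) ∧ ¬ ContainsFtr t r H ∧
      t * n.choose (r - 1) ≤ H.card + t ^ 2 * n ^ (r - 2) := by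
  obtain ⟨k, rfl⟩ : ∃ k, r = k + 2 := ⟨r - 2, by omega⟩
  simp only [Nat.add_sub_cancel, show k + 2 - 1 = k + 1 by omega]
  rcases lt_or_ge n t with hn | hn
  · refine ⟨∅, by simp, ?_, ?_⟩
    · rintro ⟨c, A, ν, hcard, -, -, -, -, hmem⟩
      exact notMem_empty _ (hmem ⟨0, by omega⟩ _
        (mem_powersetCard.2 ⟨subset_insert _ _, hcard _⟩))
    · rw [card_empty, zero_add, sq, mul_assoc]
      refine Nat.mul_le_mul_left _ ((Nat.choose_le_pow _ _).trans ?_)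
      rw [pow_succ, mul_comm]
      exact Nat.mul_le_mul_right _ hn.le
  · obtain ⟨T, -, hT⟩ := exists_subset_card_eq (s := (univ : Finset (Fin n))) (n := t) (by simpa)
    refine ⟨powersetCard (k + 2) univ \ powersetCard (k + 2) Tᶜ, ?_, ?_, ?_⟩
    · intro e he
      exact (mem_powersetCard.1 (mem_sdiff.1 he).1).2
    · refine not_containsFtr_of_cover t (k + 2) ht hr _ T hT fun e he => ?_
      rw [mem_sdiff, mem_powersetCard, mem_powersetCard] at he
      by_contra! h
      exact he.2 ⟨fun x hx => mem_compl.2 (h x hx), he.1.2⟩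
    · rw [card_sdiff_of_subset (powersetCard_mono (subset_univ _)), card_powersetCard,
        card_powersetCard, card_compl, hT, card_univ, Fintype.card_fin]
      obtain ⟨m, rfl⟩ := Nat.exists_eq_add_of_le' hn
      rw [Nat.add_sub_cancel]
      have h1 := choose_add_mul_choose_le m (k + 1) t
      have h2 := Nat.mul_le_mul_left t (choose_le_choose_add_mul_choose m k t)
      have h3 := Nat.mul_le_mul_left (t ^ 2) (Nat.choose_le_pow (m + t) k)
      have h4 : t * (m.choose (k + 1) + t * (m + t).choose k) =
        t * m.choose (k + 1) + t ^ 2 * (m + t).choose k := by ring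
      rw [show k + 1 + 1 = k + 2 from rfl] at h1
      omega

theorem turan_hypergraph_fan_expansion (t r : ℕ) (ht : 1 < t) (hr : 3 ≤ r) :
    ∃ C : ℝ, ∀ n : ℕ,
      |(exrFtr t r n : ℝ) - t * n.choose (r - 1)| ≤ C * (n : ℝ) ^ (r - 2) := by
  set C₁ := 2 ^ (r + r * (t * r)) * (r * (t * r)) ^ 2
  refine ⟨((C₁ + t ^ 2 : ℕ) : ℝ), fun n => ?_⟩
  have hup : ∀ H : Finset (Finset (Fin n)), (∀ e ∈ H, e.card = r) → ¬ ContainsFtr t r H →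
      H.card ≤ t * n.choose (r - 1) + C₁ * n ^ (r - 2) := fun H hH hF => by
    simpa using card_le_of_not_containsFtr t r ht hr H hH hF
  have hub : t * n.choose (r - 1) + C₁ * n ^ (r - 2) ∈ upperBounds
      {m | ∃ H : Finset (Finset (Fin n)),
        (∀ e ∈ H, e.card = r) ∧ ¬ ContainsFtr t r H ∧ H.card = m} := by
    rintro m ⟨H, hH, hF, rfl⟩
    exact hup H hH hF
  have h1 : exrFtr t r n ≤ t * n.choose (r - 1) + C₁ * n ^ (r - 2) := csSup_le' hub
  obtain ⟨H, hH, hF, hlow⟩ := exists_large_not_containsFtr t r n ht hr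
  have h2 : H.card ≤ exrFtr t r n := le_csSup ⟨_, hub⟩ ⟨H, hH, hF, rfl⟩
  have h3 : t * n.choose (r - 1) ≤ exrFtr t r n + t ^ 2 * n ^ (r - 2) := by omega
  have h1' : (exrFtr t r n : ℝ) ≤ t * n.choose (r - 1) + C₁ * (n : ℝ) ^ (r - 2) := by
    exact_mod_cast h1
  have h3' : (t : ℝ) * n.choose (r - 1) ≤ exrFtr t r n + (t : ℝ) ^ 2 * (n : ℝ) ^ (r - 2) := by
    exact_mod_cast h3
  have h4 : 0 ≤ (C₁ : ℝ) * (n : ℝ) ^ (r - 2) := by positivity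
  have h5 : 0 ≤ (t : ℝ) ^ 2 * (n : ℝ) ^ (r - 2) := by positivity
  rw [Nat.cast_add, Nat.cast_pow, abs_le, add_mul]
  constructor <;> linarith
end

section
/- Let t > 1 and r ≥ 3 be integers, let V be an n-vertex set and U ⊆ V a set of t vertices, and let H be the r-graph on V whose hyperedges are all r-element subsets of V that intersect U. Then H is F(t,r)-free; consequently ex_r(n, F(t,r)) ≥ C(n,r) − C(n−t,r). -/
/-- A hypergraph whose edges all meet a fixed set of at most `t` vertices contains no `F(t,r)`. -/
theorem not_containsFtr_of_forall_inter_nonempty {V : Type*} [DecidableEq V] {t r : ℕ}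
    (ht : 0 < t) (hr : 2 ≤ r) {U : Finset V} (hU : U.card ≤ t) {H : Finset (Finset V)}
    (hH : ∀ e ∈ H, (e ∩ U).Nonempty) : ¬ ContainsFtr t r H := by
  rintro ⟨c, A, ν, hcard, hc, hdisj, hν, hinj, hedge⟩
  have hAmem : ∀ i, A i ∈ (insert c (A i)).powersetCard (r - 1) := fun i =>
    Finset.mem_powersetCard.2 ⟨Finset.subset_insert _ _, hcard i⟩
  have hνinj : ∀ i j, ∀ s ∈ (insert c (A i)).powersetCard (r - 1),
      ∀ s' ∈ (insert c (A j)).powersetCard (r - 1), ν (i, s) = ν (j, s') → i = j ∧ s = s' := by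
    intro i j s hs s' hs' h
    exact Prod.mk.inj (hinj hs hs' h)
  have hAeq : ∀ i j x, x ∈ A i → x ∈ A j → i = j := by
    intro i j x hi hj
    by_contra hij
    exact Finset.disjoint_left.1 (hdisj hij) hi hj
  -- The edges expanding the `A i` are pairwise disjoint and avoid `c`.
  choose f hf using fun i => hH _ (hedge i (A i) (hAmem i))
  have hfE : ∀ i, f i = ν (i, A i) ∨ f i ∈ A i := fun i =>
    Finset.mem_insert.1 (Finset.mem_inter.1 (hf i)).1
  have hfU : ∀ i, f i ∈ U := fun i => (Finset.mem_inter.1 (hf i)).2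
  have hfinj : Function.Injective f := by
    intro i j hij
    rcases hfE i with hi | hi <;> rcases hfE j with hj | hj
    · exact (hνinj i j _ (hAmem i) _ (hAmem j) (by rw [← hi, ← hj, hij])).1
    · exact absurd (hi ▸ hij ▸ hj) ((hν i _ (hAmem i)).2 j)
    · exact absurd (hj ▸ hij ▸ hi) ((hν j _ (hAmem j)).2 i)
    · exact hAeq i j (f i) hi (hij ▸ hj)
  have hfsurj : ∀ w ∈ U, ∃ i, f i = w := by
    have himg : Finset.univ.image f = U :=
      Finset.eq_of_subset_of_card_le (Finset.image_subset_iff.2 fun i _ => hfU i)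
        (by simpa [Finset.card_image_of_injective _ hfinj] using hU)
    intro w hw
    simpa [← himg] using hw
  let k : Fin t := ⟨0, ht⟩
  obtain ⟨a, ha, hak⟩ : ∃ a ∈ A k, f k ∈ A k → a = f k := by
    by_cases h : f k ∈ A k
    · exact ⟨f k, h, fun _ => rfl⟩
    · obtain ⟨a, ha⟩ := Finset.card_pos.1 (by rw [hcard k]; omega : 0 < (A k).card)
      exact ⟨a, ha, fun h' => absurd h' h⟩
  have hs : insert c ((A k).erase a) ∈ (insert c (A k)).powersetCard (r - 1) := by
    refine Finset.mem_powersetCard.2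
      ⟨Finset.insert_subset_insert _ (Finset.erase_subset _ _), ?_⟩
    rw [Finset.card_insert_of_notMem fun h => hc k (Finset.mem_of_mem_erase h),
      Finset.card_erase_of_mem ha, hcard k]
    omega
  obtain ⟨w, hw⟩ := hH _ (hedge k _ hs)
  obtain ⟨hwe, hwU⟩ := Finset.mem_inter.1 hw
  obtain ⟨j, rfl⟩ := hfsurj w hwU
  rcases Finset.mem_insert.1 hwe with h | h
  · rcases hfE j with hj | hj
    · have hsA := (hνinj k j _ hs _ (hAmem j) (h.symm.trans hj))
      exact hc j (hsA.2 ▸ Finset.mem_insert_self _ _)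
    · exact (hν k _ hs).2 j (h ▸ hj)
  · rcases Finset.mem_insert.1 h with h | h
    · rcases hfE j with hj | hj
      · exact (hν j _ (hAmem j)).1 (hj.symm.trans h)
      · exact hc j (h ▸ hj)
    · obtain ⟨hne, hjk⟩ := Finset.mem_erase.1 h
      rcases hfE j with hj | hj
      · exact (hν j _ (hAmem j)).2 k (hj ▸ hjk)
      · obtain rfl := hAeq j k _ hj hjk
        exact hne (hak hj).symm

/-- The number of `r`-subsets of a finite type which meet a given finset `U`. -/
theorem card_powersetCard_filter_inter_nonempty {V : Type*} [Fintype V] [DecidableEq V]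
    (r : ℕ) (U : Finset V) :
    ((Finset.univ.powersetCard r).filter fun e => (e ∩ U).Nonempty).card =
      (Fintype.card V).choose r - (Fintype.card V - U.card).choose r := by
  have hcompl : (Finset.univ.powersetCard r).filter (fun e => ¬ (e ∩ U).Nonempty) =
      Uᶜ.powersetCard r := by
    ext e
    simp [Finset.mem_powersetCard, Finset.subset_compl_iff_disjoint_right,
      Finset.disjoint_iff_inter_eq_empty, and_comm]
  have hsum := Finset.card_filter_add_card_filter_not
    (s := (Finset.univ : Finset V).powersetCard r) (fun e => (e ∩ U).Nonempty)
  rw [hcompl, Finset.card_powersetCard, Finset.card_powersetCard, Finset.card_compl,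
    Finset.card_univ] at hsum
  omega

/-- An `F(t,r)`-free `r`-graph on `n` vertices bounds the Turán number from below. -/
theorem card_le_exrFtr {t r n : ℕ} {H : Finset (Finset (Fin n))}
    (hr : ∀ e ∈ H, e.card = r) (hH : ¬ ContainsFtr t r H) : H.card ≤ exrFtr t r n := by
  refine le_csSup ⟨Fintype.card (Finset (Fin n)), ?_⟩ ⟨H, hr, hH, rfl⟩
  rintro m ⟨H', -, -, rfl⟩
  exact Finset.card_le_univ H'

theorem hypergraph_fan_expansion_lower_bound (t r n : ℕ) (ht : 1 < t) (hr : 3 ≤ r)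
    (V : Type*) [Fintype V] [DecidableEq V] (hV : Fintype.card V = n)
    (U : Finset V) (hU : U.card = t)
    (H : Finset (Finset V))
    (hH : H = (Finset.univ.powersetCard r).filter fun e => (e ∩ U).Nonempty) :
    ¬ ContainsFtr t r H ∧ n.choose r - (n - t).choose r ≤ exrFtr t r n := by
  subst hH
  refine ⟨not_containsFtr_of_forall_inter_nonempty (by omega) (by omega) hU.le
    fun e he => (Finset.mem_filter.1 he).2, ?_⟩
  obtain ⟨W, -, hW⟩ := Finset.exists_subset_card_eq
    (s := (Finset.univ : Finset (Fin n))) (n := t)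
    (by simpa [← hU, ← hV] using Finset.card_le_univ U)
  have hcard := card_powersetCard_filter_inter_nonempty r W
  rw [Fintype.card_fin, hW] at hcard
  rw [← hcard]
  exact card_le_exrFtr
    (fun e he => (Finset.mem_powersetCard.1 (Finset.mem_filter.1 he).1).2)
    (not_containsFtr_of_forall_inter_nonempty (by omega) (by omega) hW.le
      fun e he => (Finset.mem_filter.1 he).2)
end
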